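/- arXiv:1709.09017 — 2 statements merged into one kernel-verified Lean document; each statement's English description precedes it below -/
import Mathlib

section
/- Let A, B', C be multiplicative characters of F_q, x ∈ F_q^* with x ≠ 1, and y ∈ F_q. Then F₁(A; ε, B'; C; x, y) = −C(−1)·₂F₁(A, B'; C; y) + ε(y)·B'C̄(x)·ĀC(1−x)·B̄'(x−y)·binom(AC̄, A)·binom(B', C) + (q−1)·C̄(x)·ĀC(x−1)·δ(x−y)·δ(B')·binom(C, A) + (q−1)·C̄(y)·B'C̄(x)·ĀC(1−x)·B̄'C(x−y)·δ(C). -/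
open Finset

namespace FFAppell

variable {F : Type*} [Field F] [Fintype F] [DecidableEq F]

/-- The multiplicative characters of a finite field form a finite type. -/
noncomputable instance : Fintype (MulChar F ℂ) := Fintype.ofFinite _

/-- The Jacobi sum `J(χ, λ) = Σ_{u ∈ F} χ(u)·λ(1−u)`. -/
noncomputable def J (χ lam : MulChar F ℂ) : ℂ := ∑ u : F, χ u * lam (1 - u)

/-- The binomial coefficient `binom(A, B) := B(−1)·J(A, B̄)`. -/
noncomputable def binom (A B : MulChar F ℂ) : ℂ := B (-1) * J A B⁻¹

/-- `δ(χ) = 1` if `χ` is the trivial character, `0` otherwise. -/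
noncomputable def δchar (χ : MulChar F ℂ) : ℂ := if χ = 1 then 1 else 0

/-- `δ(x) = 1` if `x = 0`, `0` otherwise. -/
def δ (x : F) : ℂ := if x = 0 then 1 else 0

/-- The finite-field Gauss hypergeometric function
`₂F₁(A, B; C; x) := ε(x)·BC(−1)·Σ_{y ∈ F} B(y)·B̄C(1−y)·Ā(1−xy)`,
where `ε = 1` is the trivial character (with `ε 0 = 0`). -/
noncomputable def twoF1 (A B C : MulChar F ℂ) (x : F) : ℂ :=
  (1 : MulChar F ℂ) x * (B * C) (-1) *
    ∑ y : F, B y * (B⁻¹ * C) (1 - y) * A⁻¹ (1 - x * y)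

/-- The finite-field `₃F₂` function:
`₃F₂(A₀,A₁,A₂; B₁,B₂; x) := (1/(q−1))·Σ_χ binom(A₀χ,χ)·binom(A₁χ,B₁χ)·binom(A₂χ,B₂χ)·χ(x)`. -/
noncomputable def threeF2 (A₀ A₁ A₂ B₁ B₂ : MulChar F ℂ) (x : F) : ℂ :=
  (1 / ((Fintype.card F : ℂ) - 1)) *
    ∑ χ : MulChar F ℂ, binom (A₀ * χ) χ * binom (A₁ * χ) (B₁ * χ) *
      binom (A₂ * χ) (B₂ * χ) * χ x

/-- The finite-field Appell function `F₁(A; B, B'; C; x, y)`: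
`ε(xy)·BB'(−1)·Σ_{u,v ∈ F} B(u)·B'(v)·(C·B̄·B̄')(1−u−v)·Ā(1−ux−vy)`. -/
noncomputable def AppellF1 (A B B' C : MulChar F ℂ) (x y : F) : ℂ :=
  (1 : MulChar F ℂ) (x * y) * (B * B') (-1) *
    ∑ u : F, ∑ v : F,
      B u * B' v * (C * B⁻¹ * B'⁻¹) (1 - u - v) * A⁻¹ (1 - u * x - v * y)

theorem mulChar_neg_one_mul_self {K : Type*} [Field K] (χ : MulChar K ℂ) : χ (-1) * χ (-1) = 1 := by
  rw [← map_mul]; simp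

theorem mulChar_inv_neg_one {K : Type*} [Field K] (χ : MulChar K ℂ) : χ⁻¹ (-1) = χ (-1) := by
  rw [MulChar.inv_apply']; simp

theorem mulChar_neg {K : Type*} [Field K] (χ : MulChar K ℂ) (a : K) : χ (-a) = χ (-1) * χ a := by
  rw [← map_mul, neg_one_mul]

theorem mulChar_mul_inv_self {K : Type*} [Field K] (χ : MulChar K ℂ) {a : K} (ha : a ≠ 0) : χ a * χ⁻¹ a = 1 := by
  rw [← MulChar.mul_apply, mul_inv_cancel, MulChar.one_apply (isUnit_iff_ne_zero.mpr ha)]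

theorem sum_mulLeft {K : Type*} [Field K] [Fintype K] (f : K → ℂ) {a : K} (ha : a ≠ 0) : ∑ u, f (a * u) = ∑ u, f u :=
  Fintype.sum_equiv (Equiv.mulLeft₀ a ha) _ _ fun _ => rfl

theorem sum_mulChar (χ : MulChar F ℂ) :
    ∑ u, χ u = ((Fintype.card F : ℂ) - 1) * δchar χ := by
  unfold δchar
  split_ifs with h
  · subst h
    rw [MulChar.sum_one_eq_card_units, Fintype.card_units,
      Nat.cast_sub Fintype.card_pos]
    simp
  · rw [MulChar.sum_eq_zero_of_ne_one h, mul_zero]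

/-- A character sum of `χ` against a character of an affine function is a Jacobi sum, up to a
degenerate term when the affine function is constant. -/
theorem sum_mul_affine (χ lam : MulChar F ℂ) {c : F} (hc : c ≠ 0) (s : F) :
    ∑ w, χ w * lam (c + w * s) =
      (χ * lam) c * χ⁻¹ (-s) * J χ lam +
        δ s * lam c * (((Fintype.card F : ℂ) - 1) * δchar χ) := by
  by_cases hs : s = 0
  · subst hs
    simp only [mul_zero, add_zero, ← Finset.sum_mul, sum_mulChar, neg_zero, δ, if_true]
    rw [MulChar.map_zero]
    ring
  · have ha : -(c / s) ≠ 0 := neg_ne_zero.mpr (div_ne_zero hc hs)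
    rw [← sum_mulLeft _ ha, J, Finset.mul_sum]
    simp only [δ, hs, if_false, zero_mul, add_zero]
    refine Finset.sum_congr rfl fun u _ => ?_
    have h1 : c + -(c / s) * u * s = c * (1 - u) := by field_simp; ring
    have h2 : -(c / s) * u = c * (-s)⁻¹ * u := by field_simp
    rw [h1, h2, MulChar.mul_apply, MulChar.inv_apply']
    simp only [map_mul]
    ring

theorem sum_mul_delta_affine (χ : MulChar F ℂ) {x : F} (hx : x ≠ 0) (z : F) :
    ∑ t, χ t * δ (x + t * z) = χ (-x) * χ⁻¹ z := by
  by_cases hz : z = 0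
  · subst hz
    simp [δ, hx, MulChar.map_zero]
  · rw [Finset.sum_eq_single (-x * z⁻¹), map_mul, MulChar.inv_apply']
    · simp [δ, hz]
    · intro t _ ht
      have : x + t * z ≠ 0 := fun h => ht (by field_simp; linear_combination h)
      simp [δ, this]
    · simp

theorem J_reflect (A C : MulChar F ℂ) : J C A⁻¹ = A (-1) * J (A * C⁻¹) A⁻¹ := by
  unfold J
  have e1 : ∑ u, C u * A⁻¹ (1 - u) = ∑ r, C r⁻¹ * A⁻¹ (1 - r⁻¹) :=
    (Fintype.sum_equiv (Equiv.inv F) _ _ fun _ => rfl).symm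
  rw [e1, Finset.mul_sum]
  refine Finset.sum_congr rfl fun r _ => ?_
  by_cases hr : r = 0
  · subst hr
    simp [MulChar.map_zero]
  · have h : 1 - r⁻¹ = -1 * (1 - r) * r⁻¹ := by field_simp; ring
    rw [h, MulChar.mul_apply, MulChar.inv_apply' C, map_mul, map_mul, mulChar_inv_neg_one,
      MulChar.inv_apply' A r⁻¹, inv_inv]
    ring

theorem sum_appell_kernel (B C D : MulChar F ℂ) (x z : F) (hx0 : x ≠ 0) (hx1 : 1 - x ≠ 0) :
    ∑ v, ∑ w, B v * (C * B⁻¹) w * D (1 - x + w * x + v * z) =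
      (C * D) (1 - x) * C (-1) * J C D * ∑ t, B t * C⁻¹ (x + t * z) +
        D (1 - x) * (((Fintype.card F : ℂ) - 1) * δchar C) * (B (-x) * B⁻¹ z) := by
  have scale : ∀ w, ∑ v, B v * (C * B⁻¹) w * D (1 - x + w * x + v * z) =
      ∑ t, B t * (C w * D (1 - x + w * (x + t * z))) := by
    intro w
    by_cases hw : w = 0
    · subst hw
      simp [MulChar.map_zero]
    · rw [← sum_mulLeft _ hw]
      refine Finset.sum_congr rfl fun t _ => ?_
      have h : 1 - x + w * x + w * t * z = 1 - x + w * (x + t * z) := by ring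
      rw [h, MulChar.mul_apply, map_mul]
      linear_combination (B t * C w * D (1 - x + w * (x + t * z))) * mulChar_mul_inv_self B hw
  rw [Finset.sum_comm]
  simp only [scale]
  rw [Finset.sum_comm]
  simp only [← Finset.mul_sum, sum_mul_affine C D hx1]
  rw [← sum_mul_delta_affine B hx0 z, Finset.mul_sum, Finset.mul_sum, ← Finset.sum_add_distrib]
  refine Finset.sum_congr rfl fun t _ => ?_
  rw [mulChar_neg, mulChar_inv_neg_one]
  ring

theorem appell_sum_split (A B C : MulChar F ℂ) (x y : F) :
    ∑ u, ∑ v, (1 : MulChar F ℂ) u * B v * (C * B⁻¹) (1 - u - v) * A⁻¹ (1 - u * x - v * y) =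
      ∑ v, ∑ w, B v * (C * B⁻¹) w * A⁻¹ (1 - x + w * x + v * (x - y)) -
        ∑ v, B v * (B⁻¹ * C) (1 - v) * A⁻¹ (1 - y * v) := by
  rw [Finset.sum_comm, ← Finset.sum_sub_distrib]
  refine Finset.sum_congr rfl fun v _ => ?_
  have e : ∑ w, B v * (C * B⁻¹) w * A⁻¹ (1 - x + w * x + v * (x - y)) =
      ∑ u, B v * (C * B⁻¹) (1 - u - v) * A⁻¹ (1 - u * x - v * y) := by
    refine (Fintype.sum_equiv (Equiv.subLeft (1 - v)) _ _ fun u => ?_).symm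
    simp only [Equiv.subLeft_apply]
    congr 2 <;> congr 1 <;> ring
  have h0 : B v * (B⁻¹ * C) (1 - v) * A⁻¹ (1 - y * v) =
      ∑ u, if u = 0 then B v * (C * B⁻¹) (1 - u - v) * A⁻¹ (1 - u * x - v * y) else 0 := by
    rw [Finset.sum_ite_eq' Finset.univ (0 : F)]
    simp [mul_comm]
  rw [e, h0, ← Finset.sum_sub_distrib]
  refine Finset.sum_congr rfl fun u _ => ?_
  by_cases hu : u = 0
  · subst hu
    simp [MulChar.map_zero]
  · simp [hu, MulChar.one_apply (isUnit_iff_ne_zero.mpr hu)]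

/-- Theorem 3.3: reduction formula for `F₁(A; ε, B'; C; x, y)` with `x ∈ F_q^* \ {1}`. -/
theorem appellF1_reduction_left_trivial (A B' C : MulChar F ℂ) (x y : F)
    (hx0 : x ≠ 0) (hx1 : x ≠ 1) :
    AppellF1 A (1 : MulChar F ℂ) B' C x y =
      -(C (-1)) * twoF1 A B' C y
      + (1 : MulChar F ℂ) y * (B' * C⁻¹) x * (A⁻¹ * C) (1 - x) * B'⁻¹ (x - y) *
          binom (A * C⁻¹) A * binom B' C
      + ((Fintype.card F : ℂ) - 1) * C⁻¹ x * (A⁻¹ * C) (x - 1) * δ (x - y) * δchar B' *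
          binom C A
      + ((Fintype.card F : ℂ) - 1) * C⁻¹ y * (B' * C⁻¹) x * (A⁻¹ * C) (1 - x) *
          (B'⁻¹ * C) (x - y) * δchar C := by
  have hx1' : 1 - x ≠ 0 := sub_ne_zero.mpr hx1.symm
  by_cases hy : y = 0
  · subst hy
    have h : δ (x - 0) = 0 := by simp [δ, hx0]
    simp only [AppellF1, twoF1, h, mul_zero, MulChar.map_zero]
    ring
  have hA := mulChar_neg_one_mul_self A
  have hB := mulChar_neg_one_mul_self B'
  have hC := mulChar_neg_one_mul_self C
  have ex : (1 : MulChar F ℂ) (x * y) = 1 :=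
    MulChar.one_apply (isUnit_iff_ne_zero.mpr (mul_ne_zero hx0 hy))
  have ey : (1 : MulChar F ℂ) y = 1 := MulChar.one_apply (isUnit_iff_ne_zero.mpr hy)
  have degenerate : C⁻¹ y * (B' * C⁻¹) x * (A⁻¹ * C) (1 - x) * (B'⁻¹ * C) (x - y) * δchar C =
      B' x * A⁻¹ (1 - x) * B'⁻¹ (x - y) * δchar C := by
    by_cases h : C = 1
    · subst h
      simp [ey]
    · simp [δchar, h]
  have reflect := J_reflect A C
  have hneg : x - 1 = -(1 - x) := by ring
  simp only [AppellF1, twoF1, binom, inv_one, mul_one, one_mul, ex, ey]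
  rw [appell_sum_split, sum_appell_kernel B' C A⁻¹ x (x - y) hx0 hx1',
    sum_mul_affine B' C⁻¹ hx0 (x - y), mulChar_neg B'⁻¹ (x - y), mulChar_neg B' x,
    mulChar_inv_neg_one, hneg, mulChar_neg (A⁻¹ * C) (1 - x)]
  have deltaB : B' (-1) * δchar B' = δchar B' := by
    by_cases h : B' = 1
    · subst h
      rw [MulChar.one_apply isUnit_one.neg, one_mul]
    · simp [δchar, h]
  simp only [MulChar.mul_apply, mulChar_inv_neg_one] at degenerate ⊢
  generalize ((Fintype.card F : ℂ) - 1) = q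
  linear_combination (C (1 - x) * A⁻¹ (1 - x) * C (-1) * J C A⁻¹ * C⁻¹ x * δ (x - y) * q) * deltaB
    - (C (1 - x) * A⁻¹ (1 - x) * C (-1) * J C A⁻¹ * C⁻¹ x * δ (x - y) * q * δchar B') * hA
    + (B' (-1) * ∑ v, B' v * (B'⁻¹ (1 - v) * C (1 - v)) * A⁻¹ (1 - y * v)) * hC
    + (C (1 - x) * A⁻¹ (1 - x) * C (-1) * J C A⁻¹ * B' x * C⁻¹ x * B'⁻¹ (x - y) * J B' C⁻¹) * hB
    + (C (1 - x) * A⁻¹ (1 - x) * C (-1) * B' x * C⁻¹ x * B'⁻¹ (x - y) * J B' C⁻¹) * reflect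
    + (A⁻¹ (1 - x) * B' x * B'⁻¹ (x - y) * q * δchar C) * hB
    - q * degenerate

end FFAppell
end

section
/- Let A, B, B', C be multiplicative characters of F_q, x ∈ F_q, and y ∈ F_q^* with y ≠ 1. Then F₁(A; B, B'; C; x, y) = (1/(q−1)²)·Σ_{λ,μ} binom(B̄B̄'C, B̄'Cλ)·binom(Aλ, λ)·binom(Aλμ, μ)·binom(B̄'Cλ, Cλμ)·λ(−x)·μ(−y) + C(−1)·binom(AB'C̄, B'C̄)·B'C̄(x)·ĀB̄'C(1−y) + BC(−1)·Ā(x)·AC̄(y)·binom(AB'C̄, AB̄)·ĀB̄'C(1−y), where the double sum ranges over all multiplicative characters λ, μ of F_q. -/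
open Finset

namespace FFAppell

variable {F : Type*} [Field F] [Fintype F] [DecidableEq F]

omit [Fintype F] [DecidableEq F] in
lemma mulChar_apply_inv (χ : MulChar F ℂ) (a : F) : χ a⁻¹ = (χ a)⁻¹ := by
  rw [← MulChar.inv_apply', MulChar.inv_apply_eq_inv']

omit [Fintype F] [DecidableEq F] in
lemma mulChar_neg_one_sq (χ : MulChar F ℂ) : χ (-1) * χ (-1) = 1 := by
  rw [← map_mul]; simp

omit [Fintype F] [DecidableEq F] in
lemma mulChar_neg_one_inv (χ : MulChar F ℂ) : (χ (-1))⁻¹ = χ (-1) :=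
  inv_eq_of_mul_eq_one_left (mulChar_neg_one_sq χ)

omit [Fintype F] [DecidableEq F] in
lemma mulChar_apply_neg (χ : MulChar F ℂ) (a : F) : χ (-a) = χ (-1) * χ a := by
  rw [← map_mul, neg_one_mul]

omit [Fintype F] [DecidableEq F] in
lemma mulChar_apply_ne_zero (χ : MulChar F ℂ) {a : F} (ha : a ≠ 0) : χ a ≠ 0 :=
  ((Ne.isUnit ha).map χ).ne_zero

omit [Fintype F] [DecidableEq F] in
lemma one_mulChar_apply {a : F} (ha : a ≠ 0) : (1 : MulChar F ℂ) a = 1 :=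
  MulChar.one_apply (Ne.isUnit ha)

/-- Orthogonality of multiplicative characters. -/
lemma sum_mulChar_apply (a : F) :
    ∑ χ : MulChar F ℂ, χ a = if a = 1 then (Fintype.card F : ℂ) - 1 else 0 := by
  split_ifs with ha
  · subst ha
    have h := MulChar.card_eq_card_units_of_hasEnoughRootsOfUnity F ℂ
    rw [Nat.card_eq_fintype_card, Nat.card_eq_fintype_card, Fintype.card_units] at h
    simp [h, Nat.cast_sub Fintype.card_pos]
  · obtain ⟨χ, hχ⟩ := MulChar.exists_apply_ne_one_of_hasEnoughRootsOfUnity F ℂ ha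
    refine eq_zero_of_mul_eq_self_left hχ ?_
    simp only [Finset.mul_sum, ← MulChar.mul_apply]
    exact Fintype.sum_bijective _ (Group.mulLeft_bijective χ) _ _ fun χ' ↦ rfl

omit [DecidableEq F] in
lemma sum_comp_one_sub_inv (f : F → ℂ) : ∑ v : F, f (1 - v)⁻¹ = ∑ v : F, f v :=
  Fintype.sum_bijective (fun v : F ↦ (1 - v)⁻¹)
    (inv_bijective.comp (Equiv.subLeft (1 : F)).bijective) _ _ fun _ ↦ rfl

omit [DecidableEq F] in
lemma sum_comp_mul_left {c : F} (hc : c ≠ 0) (f : F → ℂ) : ∑ v : F, f (c * v) = ∑ v : F, f v :=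
  Fintype.sum_equiv (Equiv.mulLeft₀ c hc) _ _ fun _ ↦ rfl

omit [DecidableEq F] in
lemma J_comm (a b : MulChar F ℂ) : J a b = J b a := by
  unfold J
  exact Fintype.sum_equiv (Equiv.subLeft (1 : F)) _ _ fun v ↦ by simp [mul_comm]

omit [DecidableEq F] in
lemma J_eq_J_mul_inv (a b : MulChar F ℂ) : J a b = a (-1) * J a (a * b)⁻¹ := by
  rw [J_comm]
  unfold J
  rw [← sum_comp_one_sub_inv, Finset.mul_sum]
  refine Finset.sum_congr rfl fun w _ ↦ ?_
  by_cases hw : 1 - w = 0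
  · simp [hw, MulChar.map_zero]
  · have h : 1 - (1 - w)⁻¹ = (-1) * w * (1 - w)⁻¹ := by field_simp; ring
    rw [h]
    simp only [map_mul, MulChar.inv_apply_eq_inv', mulChar_apply_inv, MulChar.mul_apply, mul_inv]
    ring

omit [DecidableEq F] in
lemma sum_apply_mul_apply_sub (a b : MulChar F ℂ) {c x : F} (hc : c ≠ 0) (hx : x ≠ 0) :
    ∑ u : F, a u * b (c - u * x) = a c * (a x)⁻¹ * b c * J a b := by
  unfold J
  rw [← sum_comp_mul_left (mul_ne_zero hc (inv_ne_zero hx)), Finset.mul_sum]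
  refine Finset.sum_congr rfl fun w _ ↦ ?_
  have h : c - c * x⁻¹ * w * x = c * (1 - w) := by field_simp
  rw [h]
  simp only [map_mul, mulChar_apply_inv]
  ring

/-- The finite field binomial theorem. -/
lemma sum_binom_mul_apply (A : MulChar F ℂ) (z : F) :
    ∑ χ : MulChar F ℂ, binom (A * χ) χ * χ z =
      ((Fintype.card F : ℂ) - 1) * ((1 : MulChar F ℂ) z * A⁻¹ (1 - z)) := by
  by_cases hz : z = 0
  · simp [hz, MulChar.map_zero]
  have h : ∀ χ : MulChar F ℂ, binom (A * χ) χ * χ z =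
      ∑ u : F, A u * χ (-z * u * (1 - u)⁻¹) := by
    intro χ
    unfold binom J
    rw [Finset.mul_sum, Finset.sum_mul]
    refine Finset.sum_congr rfl fun u _ ↦ ?_
    simp only [map_mul, MulChar.inv_apply_eq_inv', mulChar_apply_inv, MulChar.mul_apply,
      mulChar_apply_neg χ z]
    ring
  rw [Finset.sum_congr rfl fun χ _ ↦ h χ, Finset.sum_comm]
  have h' : ∀ u : F, ∑ χ : MulChar F ℂ, A u * χ (-z * u * (1 - u)⁻¹) =
      if u = (1 - z)⁻¹ then A u * ((Fintype.card F : ℂ) - 1) else 0 := by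
    intro u
    rw [← Finset.mul_sum, sum_mulChar_apply]
    by_cases hu : u = (1 - z)⁻¹
    · rw [if_pos hu]
      by_cases hz1 : 1 - z = 0
      · simp [hu, hz1, MulChar.map_zero]
      · have h1 : 1 - u = -z * u := by rw [hu]; field_simp; ring
        have h0 : -z * u ≠ 0 := by rw [hu]; exact mul_ne_zero (neg_ne_zero.2 hz) (inv_ne_zero hz1)
        rw [h1, mul_inv_cancel₀ h0, if_pos rfl]
    · rw [if_neg hu, if_neg, mul_zero]
      intro h1
      refine hu (eq_inv_of_mul_eq_one_left ?_)
      have h0 : 1 - u ≠ 0 := by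
        intro h0
        simp [h0] at h1
      rw [← div_eq_mul_inv, div_eq_one_iff_eq h0] at h1
      linear_combination h1
  rw [Finset.sum_congr rfl fun u _ ↦ h' u, Finset.sum_ite_eq', if_pos (Finset.mem_univ _),
    one_mulChar_apply hz, mulChar_apply_inv, MulChar.inv_apply_eq_inv']
  ring

lemma sum_binom_mul_binom_mul_apply (P D E : MulChar F ℂ) (z : F) :
    ∑ χ : MulChar F ℂ, binom (P * χ) χ * binom D (E * χ) * χ z =
      ((Fintype.card F : ℂ) - 1) * ∑ v : F, E (-1) * D v * E⁻¹ (1 - v) *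
        ((1 : MulChar F ℂ) (-z * (1 - v)⁻¹) * P⁻¹ (1 - -z * (1 - v)⁻¹)) := by
  have h : ∀ χ : MulChar F ℂ, binom (P * χ) χ * binom D (E * χ) * χ z =
      ∑ v : F, E (-1) * D v * E⁻¹ (1 - v) * (binom (P * χ) χ * χ (-z * (1 - v)⁻¹)) := by
    intro χ
    rw [binom.eq_1 D, J, Finset.mul_sum, Finset.mul_sum, Finset.sum_mul]
    refine Finset.sum_congr rfl fun v _ ↦ ?_
    simp only [map_mul, MulChar.inv_apply_eq_inv', mulChar_apply_inv, MulChar.mul_apply,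
      mulChar_apply_neg χ z, mul_inv]
    ring
  rw [Finset.sum_congr rfl fun χ _ ↦ h χ, Finset.sum_comm, Finset.mul_sum]
  refine Finset.sum_congr rfl fun v _ ↦ ?_
  rw [← Finset.mul_sum, sum_binom_mul_apply]
  ring

/-- The double character sum, written as a double sum over the field. -/
lemma double_sum_binom (A B B' C : MulChar F ℂ) (x y : F) :
    ∑ lam : MulChar F ℂ, ∑ mu : MulChar F ℂ,
      binom (B⁻¹ * B'⁻¹ * C) (B'⁻¹ * C * lam) * binom (A * lam) lam *
        binom (A * lam * mu) mu * binom (B'⁻¹ * C * lam) (C * lam * mu) *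
        lam (-x) * mu (-y) =
      ((Fintype.card F : ℂ) - 1) ^ 2 * ∑ v : F,
        C (-1) * (B'⁻¹ * C) v * C⁻¹ (1 - v) *
          ((1 : MulChar F ℂ) (y * (1 - v)⁻¹) * A⁻¹ (1 - y * (1 - v)⁻¹)) *
          ∑ t : F, (B'⁻¹ * C) (-1) * (B⁻¹ * B'⁻¹ * C) t * (B'⁻¹ * C)⁻¹ (1 - t) *
            ((1 : MulChar F ℂ) (-(x * v * (1 - v)⁻¹ * (1 - y * (1 - v)⁻¹)⁻¹) * (1 - t)⁻¹) *
              A⁻¹ (1 - -(x * v * (1 - v)⁻¹ * (1 - y * (1 - v)⁻¹)⁻¹) * (1 - t)⁻¹)) := by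
  have h : ∀ lam : MulChar F ℂ, ∑ mu : MulChar F ℂ,
      binom (B⁻¹ * B'⁻¹ * C) (B'⁻¹ * C * lam) * binom (A * lam) lam *
        binom (A * lam * mu) mu * binom (B'⁻¹ * C * lam) (C * lam * mu) *
        lam (-x) * mu (-y) =
      ∑ v : F, ((Fintype.card F : ℂ) - 1) * (C (-1) * (B'⁻¹ * C) v * C⁻¹ (1 - v) *
          ((1 : MulChar F ℂ) (y * (1 - v)⁻¹) * A⁻¹ (1 - y * (1 - v)⁻¹))) *
        (binom (A * lam) lam * binom (B⁻¹ * B'⁻¹ * C) (B'⁻¹ * C * lam) *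
          lam (x * v * (1 - v)⁻¹ * (1 - y * (1 - v)⁻¹)⁻¹)) := by
    intro lam
    calc _ = binom (B⁻¹ * B'⁻¹ * C) (B'⁻¹ * C * lam) * binom (A * lam) lam * lam (-x) *
          ∑ mu : MulChar F ℂ, binom (A * lam * mu) mu *
            binom (B'⁻¹ * C * lam) (C * lam * mu) * mu (-y) := by
          rw [Finset.mul_sum]
          exact Finset.sum_congr rfl fun mu _ ↦ by ring
      _ = _ := by
          rw [sum_binom_mul_binom_mul_apply, neg_neg, Finset.mul_sum, Finset.mul_sum]
          refine Finset.sum_congr rfl fun v _ ↦ ?_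
          have hs := mulChar_neg_one_sq lam
          simp only [map_mul, MulChar.inv_apply_eq_inv', mulChar_apply_inv, MulChar.mul_apply,
            mulChar_apply_neg lam x, mul_inv]
          linear_combination (binom (B⁻¹ * B'⁻¹ * C) (B'⁻¹ * C * lam) *
            binom (A * lam) lam * lam x * ((Fintype.card F : ℂ) - 1) * C (-1) * (B' v)⁻¹ * C v *
            lam v * (C (1 - v))⁻¹ * (lam (1 - v))⁻¹ * (1 : MulChar F ℂ) y *
            ((1 : MulChar F ℂ) (1 - v))⁻¹ * (A (1 - y * (1 - v)⁻¹))⁻¹ *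
            (lam (1 - y * (1 - v)⁻¹))⁻¹) * hs
  rw [Finset.sum_congr rfl fun lam _ ↦ h lam, Finset.sum_comm, Finset.mul_sum]
  refine Finset.sum_congr rfl fun v _ ↦ ?_
  rw [← Finset.mul_sum, sum_binom_mul_binom_mul_apply]
  ring

/-- The change of variables relating the Appell sum to the double character sum. -/
lemma appell_slice (A B B' C : MulChar F ℂ) {x y v : F} (hx : x ≠ 0) (hy : y ≠ 0)
    (hv0 : v ≠ 0) (hv1 : 1 - v ≠ 0) (hvy : v ≠ 1 - y) :
    (B * B') (-1) * ∑ u : F, B u * B' (1 - v)⁻¹ * (C * B⁻¹ * B'⁻¹) (1 - u - (1 - v)⁻¹) *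
        A⁻¹ (1 - u * x - (1 - v)⁻¹ * y) =
      C (-1) * (B'⁻¹ * C) v * C⁻¹ (1 - v) *
        ((1 : MulChar F ℂ) (y * (1 - v)⁻¹) * A⁻¹ (1 - y * (1 - v)⁻¹)) *
        ∑ t : F, (B'⁻¹ * C) (-1) * (B⁻¹ * B'⁻¹ * C) t * (B'⁻¹ * C)⁻¹ (1 - t) *
          ((1 : MulChar F ℂ) (-(x * v * (1 - v)⁻¹ * (1 - y * (1 - v)⁻¹)⁻¹) * (1 - t)⁻¹) *
            A⁻¹ (1 - -(x * v * (1 - v)⁻¹ * (1 - y * (1 - v)⁻¹)⁻¹) * (1 - t)⁻¹)) := by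
  have hw : 1 - y * (1 - v)⁻¹ ≠ 0 := by
    intro h
    field_simp at h
    exact hvy (by linear_combination -h)
  have hc : (-1) * v * (1 - v)⁻¹ ≠ 0 :=
    mul_ne_zero (mul_ne_zero (neg_ne_zero.2 one_ne_zero) hv0) (inv_ne_zero hv1)
  rw [← sum_comp_mul_left hc, ← sum_comp_one_sub_inv, Finset.mul_sum, Finset.mul_sum]
  refine Finset.sum_congr rfl fun t _ ↦ ?_
  by_cases ht : 1 - t = 0
  · simp [ht, MulChar.map_zero]
  have e1 : 1 - (-1) * v * (1 - v)⁻¹ * (1 - t)⁻¹ - (1 - v)⁻¹ =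
      v * t * (1 - v)⁻¹ * (1 - t)⁻¹ := by field_simp; ring
  have e2 : 1 - (-1) * v * (1 - v)⁻¹ * (1 - t)⁻¹ * x - (1 - v)⁻¹ * y =
      (1 - y * (1 - v)⁻¹) *
        (1 - -(x * v * (1 - v)⁻¹ * (1 - y * (1 - v)⁻¹)⁻¹) * (1 - t)⁻¹) := by
    generalize hW : 1 - y * (1 - v)⁻¹ = W at hw ⊢
    have : W * (1 - -(x * v * (1 - v)⁻¹ * W⁻¹) * (1 - t)⁻¹) =
      W + x * v * (1 - v)⁻¹ * (1 - t)⁻¹ := by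
      rw [mul_sub, mul_one]
      linear_combination (x * v * (1 - v)⁻¹ * (1 - t)⁻¹) * mul_inv_cancel₀ hw
    rw [this, ← hW]
    ring
  have o1 : (1 : MulChar F ℂ) (y * (1 - v)⁻¹) = 1 :=
    one_mulChar_apply (mul_ne_zero hy (inv_ne_zero hv1))
  have o2 : (1 : MulChar F ℂ)
      (-(x * v * (1 - v)⁻¹ * (1 - y * (1 - v)⁻¹)⁻¹) * (1 - t)⁻¹) = 1 := by
    refine one_mulChar_apply (mul_ne_zero (neg_ne_zero.2 ?_) (inv_ne_zero ht))
    exact mul_ne_zero (mul_ne_zero (mul_ne_zero hx hv0) (inv_ne_zero hv1)) (inv_ne_zero hw)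
  rw [e1, e2, o1, o2]
  generalize 1 - -(x * v * (1 - v)⁻¹ * (1 - y * (1 - v)⁻¹)⁻¹) * (1 - t)⁻¹ = Z
  generalize 1 - y * (1 - v)⁻¹ = W
  simp only [map_mul, MulChar.inv_apply_eq_inv', mulChar_apply_inv, MulChar.mul_apply, mul_inv,
    mulChar_neg_one_inv, inv_inv]
  have n1 := mul_inv_cancel₀ (mulChar_apply_ne_zero B hv0)
  have n2 := mul_inv_cancel₀ (mulChar_apply_ne_zero B hv1)
  have n3 := mul_inv_cancel₀ (mulChar_apply_ne_zero B ht)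
  have n4 := mul_inv_cancel₀ (mulChar_apply_ne_zero B' hv1)
  have sB := mulChar_neg_one_sq B
  have sC := mulChar_neg_one_sq C
  set R := B' (-1) * (B t)⁻¹ * (B' t)⁻¹ * C t * B' (1 - t) * (C (1 - t))⁻¹ * (B' v)⁻¹ * C v *
    (C (1 - v))⁻¹ * (A W)⁻¹ * (A Z)⁻¹ with hR
  trans R
  · calc _ = B (-1) * B (-1) * (B v * (B v)⁻¹) * (B (1 - v) * (B (1 - v))⁻¹) *
          (B (1 - t) * (B (1 - t))⁻¹) * (B' (1 - v) * (B' (1 - v))⁻¹) * R := by rw [hR]; ring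
      _ = R := by rw [sB, n1, n2, n3, n4]; ring
  · calc R = C (-1) * C (-1) * R := by rw [sC, one_mul]
      _ = _ := by rw [hR]; ring

omit [DecidableEq F] in
lemma appell_term_one (A B B' C : MulChar F ℂ) {x y : F} (hx : x ≠ 0) (hy1 : y ≠ 1) :
    (B * B') (-1) * ∑ u : F, B u * B' 1 * (C * B⁻¹ * B'⁻¹) (1 - u - 1) *
        A⁻¹ (1 - u * x - 1 * y) =
      C (-1) * binom (A * B' * C⁻¹) (B' * C⁻¹) * (B' * C⁻¹) x * (A⁻¹ * B'⁻¹ * C) (1 - y) := by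
  have hy : 1 - y ≠ 0 := sub_ne_zero.2 hy1.symm
  have hJ : binom (A * B' * C⁻¹) (B' * C⁻¹) = J (C * B'⁻¹) A⁻¹ := by
    rw [binom, J_eq_J_mul_inv (C * B'⁻¹), J_comm]
    simp [MulChar.inv_apply_eq_inv', mulChar_neg_one_inv, mul_comm, mul_left_comm]
  have hs : ∀ u : F, B u * B' 1 * (C * B⁻¹ * B'⁻¹) (1 - u - 1) * A⁻¹ (1 - u * x - 1 * y) =
      (C * B⁻¹ * B'⁻¹) (-1) * ((C * B'⁻¹) u * A⁻¹ (1 - y - u * x)) := by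
    intro u
    by_cases hu : u = 0
    · simp [hu, MulChar.map_zero]
    have n := mul_inv_cancel₀ (mulChar_apply_ne_zero B hu)
    rw [show 1 - u - 1 = (-1) * u by ring, show 1 - u * x - 1 * y = 1 - y - u * x by ring]
    simp only [map_mul, map_one, MulChar.inv_apply_eq_inv', MulChar.mul_apply]
    linear_combination (C (-1) * (B (-1))⁻¹ * (B' (-1))⁻¹ * C u * (B' u)⁻¹ *
      (A (1 - y - u * x))⁻¹) * n
  rw [Finset.sum_congr rfl fun u _ ↦ hs u, ← Finset.mul_sum, sum_apply_mul_apply_sub _ _ hy hx, hJ]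
  simp only [MulChar.inv_apply_eq_inv', MulChar.mul_apply, mulChar_neg_one_inv, mul_inv, inv_inv]
  generalize J (C * B'⁻¹) A⁻¹ = j
  calc _ = B (-1) * B (-1) * (B' (-1) * B' (-1)) * (C (-1) * j * (B' x * (C x)⁻¹) *
        ((A (1 - y))⁻¹ * (B' (1 - y))⁻¹ * C (1 - y))) := by ring
    _ = _ := by rw [mulChar_neg_one_sq, mulChar_neg_one_sq]; ring

omit [DecidableEq F] in
lemma appell_term_two (A B B' C : MulChar F ℂ) {x y : F} (hy0 : y ≠ 0) (hy1 : y ≠ 1) :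
    (B * B') (-1) * ∑ u : F, B u * B' y⁻¹ * (C * B⁻¹ * B'⁻¹) (1 - u - y⁻¹) *
        A⁻¹ (1 - u * x - y⁻¹ * y) =
      (B * C) (-1) * A⁻¹ x * (A * C⁻¹) y * binom (A * B' * C⁻¹) (A * B⁻¹) *
          (A⁻¹ * B'⁻¹ * C) (1 - y) := by
  have hy : 1 - y ≠ 0 := sub_ne_zero.2 hy1.symm
  have hc : (-1) * (1 - y) * y⁻¹ ≠ 0 :=
    mul_ne_zero (mul_ne_zero (neg_ne_zero.2 one_ne_zero) hy) (inv_ne_zero hy0)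
  have hJ : binom (A * B' * C⁻¹) (A * B⁻¹) = J (B * A⁻¹) (C * B⁻¹ * B'⁻¹) := by
    rw [binom, J_eq_J_mul_inv (B * A⁻¹), J_comm]
    have e : (B * A⁻¹ * (C * B⁻¹ * B'⁻¹))⁻¹ = A * B' * C⁻¹ := by
      rw [show B * A⁻¹ * (C * B⁻¹ * B'⁻¹) = B * B⁻¹ * (A⁻¹ * C * B'⁻¹) by ac_rfl,
        mul_inv_cancel, one_mul, mul_inv, mul_inv, inv_inv, inv_inv]
      ac_rfl
    rw [e]
    simp [MulChar.inv_apply_eq_inv', mulChar_neg_one_inv, mul_comm]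
  have hs : ∀ u : F, B u * B' y⁻¹ * (C * B⁻¹ * B'⁻¹) (1 - u - y⁻¹) *
        A⁻¹ (1 - u * x - y⁻¹ * y) =
      B' y⁻¹ * A⁻¹ (-1) * A⁻¹ x * ((B * A⁻¹) u *
        (C * B⁻¹ * B'⁻¹) ((-1) * (1 - y) * y⁻¹ - u * 1)) := by
    intro u
    rw [show 1 - u * x - y⁻¹ * y = (-1) * u * x by rw [inv_mul_cancel₀ hy0]; ring,
      show 1 - u - y⁻¹ = (-1) * (1 - y) * y⁻¹ - u * 1 by field_simp; ring,
      MulChar.mul_apply B, map_mul, map_mul]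
    ring
  rw [Finset.sum_congr rfl fun u _ ↦ hs u, ← Finset.mul_sum,
    sum_apply_mul_apply_sub _ _ hc one_ne_zero, hJ]
  generalize J (B * A⁻¹) (C * B⁻¹ * B'⁻¹) = j
  simp only [MulChar.inv_apply_eq_inv', MulChar.mul_apply, mulChar_neg_one_inv, inv_inv,
    map_mul, mulChar_apply_inv, map_one, inv_one]
  have n1 := mul_inv_cancel₀ (mulChar_apply_ne_zero B hy)
  have n2 := mul_inv_cancel₀ (mulChar_apply_ne_zero B hy0)
  have n3 := mul_inv_cancel₀ (mulChar_apply_ne_zero B' hy0)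
  calc _ = B (-1) * B (-1) * (B' (-1) * B' (-1)) * (A (-1) * A (-1)) *
        (B (1 - y) * (B (1 - y))⁻¹) * (B y * (B y)⁻¹) * (B' y * (B' y)⁻¹) *
        (B (-1) * C (-1) * (A x)⁻¹ * (A y * (C y)⁻¹) * j *
          ((A (1 - y))⁻¹ * (B' (1 - y))⁻¹ * C (1 - y))) := by ring
    _ = _ := by
      rw [mulChar_neg_one_sq, mulChar_neg_one_sq, mulChar_neg_one_sq, n1, n2, n3]; ring

/-- Expression for `F₁(A; B, B'; C; x, y)` when `y ∈ F_q^* \ {1}`. -/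
theorem appellF1_expression_y_ne_one (A B B' C : MulChar F ℂ) (x y : F)
    (hy0 : y ≠ 0) (hy1 : y ≠ 1) :
    AppellF1 A B B' C x y =
      (1 / ((Fintype.card F : ℂ) - 1) ^ 2) *
        ∑ lam : MulChar F ℂ, ∑ mu : MulChar F ℂ,
          binom (B⁻¹ * B'⁻¹ * C) (B'⁻¹ * C * lam) * binom (A * lam) lam *
            binom (A * lam * mu) mu * binom (B'⁻¹ * C * lam) (C * lam * mu) *
            lam (-x) * mu (-y)
      + C (-1) * binom (A * B' * C⁻¹) (B' * C⁻¹) * (B' * C⁻¹) x * (A⁻¹ * B'⁻¹ * C) (1 - y)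
      + (B * C) (-1) * A⁻¹ x * (A * C⁻¹) y * binom (A * B' * C⁻¹) (A * B⁻¹) *
          (A⁻¹ * B'⁻¹ * C) (1 - y) := by
  by_cases hx : x = 0
  · simp [AppellF1, hx, MulChar.map_zero]
  have hq : ((Fintype.card F : ℂ) - 1) ^ 2 ≠ 0 :=
    pow_ne_zero _ (sub_ne_zero.2 (by exact_mod_cast (Fintype.one_lt_card (α := F)).ne'))
  rw [double_sum_binom, ← mul_assoc, one_div_mul_cancel hq, one_mul,
    ← appell_term_one A B B' C hx hy1, ← appell_term_two A B B' C hy0 hy1, AppellF1,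
    one_mulChar_apply (mul_ne_zero hx hy0), one_mul, Finset.sum_comm, ← sum_comp_one_sub_inv,
    Finset.mul_sum]
  generalize ht₁ : (B * B') (-1) * ∑ u : F, B u * B' 1 * (C * B⁻¹ * B'⁻¹) (1 - u - 1) *
    A⁻¹ (1 - u * x - 1 * y) = t₁
  generalize ht₂ : (B * B') (-1) * ∑ u : F, B u * B' y⁻¹ * (C * B⁻¹ * B'⁻¹) (1 - u - y⁻¹) *
    A⁻¹ (1 - u * x - y⁻¹ * y) = t₂
  rw [← Fintype.sum_ite_eq (0 : F) fun _ ↦ t₁, ← Fintype.sum_ite_eq (1 - y : F) fun _ ↦ t₂,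
    ← Finset.sum_add_distrib, ← Finset.sum_add_distrib]
  refine Finset.sum_congr rfl fun v _ ↦ ?_
  have hy : 1 - y ≠ 0 := sub_ne_zero.2 hy1.symm
  rcases eq_or_ne v 0 with rfl | hv0
  · simp [hy, ← ht₁, MulChar.map_zero]
  rcases eq_or_ne v (1 - y) with rfl | hvy
  · simp [hy.symm, hy0, ← ht₂, MulChar.map_zero]
  rw [if_neg hv0.symm, if_neg hvy.symm, add_zero, add_zero]
  by_cases hv1 : 1 - v = 0
  · simp [hv1, MulChar.map_zero]
  exact appell_slice A B B' C hx hy0 hv0 hv1 hvy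

end FFAppell
end
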